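/- arXiv:1306.3827 — 4 statements merged into one kernel-verified Lean document; each statement's English description precedes it below -/
import Mathlib

section
/- Let T : L¹(μ) → L¹(μ) be a bounded linear operator with operator norm ‖T‖, and let x ∈ L¹(μ) with x ≥ 0. Define E(x) = { |T x₁| + … + |T xₙ| : n ∈ ℕ, x₁, …, xₙ ∈ L¹(μ), xᵢ ≥ 0 for each i, and x₁ + … + xₙ = x }. Then ‖y‖₁ ≤ ‖T‖·‖x‖₁ for every y ∈ E(x), and E(x) is bounded above in the lattice L¹(μ): there exists z ∈ L¹(μ) such that y ≤ z for every y ∈ E(x). -/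
open MeasureTheory Filter Topology
open scoped ENNReal NNReal

/-- `E T x` is the set of all elements of the form `|T x₁| + ⋯ + |T xₙ|` where
`x₁, …, xₙ ≥ 0` and `x₁ + ⋯ + xₙ = x`. -/
def besbasSet {X : Type*} [MeasurableSpace X] {μ : Measure X}
    (T : Lp ℝ 1 μ →L[ℝ] Lp ℝ 1 μ) (x : Lp ℝ 1 μ) : Set (Lp ℝ 1 μ) :=
  {y | ∃ (n : ℕ) (f : Fin n → Lp ℝ 1 μ),
    (∀ i, 0 ≤ f i) ∧ (∑ i, f i) = x ∧ y = ∑ i, |T (f i)|}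

theorem aux_dec {L : Type*} [AddCommGroup L] [Lattice L] [IsOrderedAddMonoid L] :
    ∀ (n : ℕ) (f : Fin n → L) (g : L), (∀ i, 0 ≤ f i) → 0 ≤ g → g ≤ ∑ i, f i →
      ∃ h : Fin n → L, (∀ i, 0 ≤ h i) ∧ (∀ i, h i ≤ f i) ∧ ∑ i, h i = g := by
  intro n
  induction n with
  | zero =>
    intro f g hf hg hgf
    simp only [Finset.univ_eq_empty, Finset.sum_empty] at hgf
    exact ⟨f, fun i => i.elim0, fun i => i.elim0, by simpa using le_antisymm hg hgf⟩
  | succ n ih =>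
    intro f g hf hg hgf
    rw [Fin.sum_univ_succ] at hgf
    have h1 : g - g ⊓ f 0 ≤ ∑ i : Fin n, f i.succ := by
      rw [sub_le_comm]
      refine le_inf (sub_le_self _ (Finset.sum_nonneg fun i _ => hf _)) ?_
      rw [sub_le_iff_le_add]
      exact hgf
    obtain ⟨h, hh0, hhf, hs⟩ := ih (fun i => f i.succ) (g - g ⊓ f 0) (fun i => hf _)
      (sub_nonneg.2 inf_le_left) h1
    refine ⟨Fin.cons (g ⊓ f 0) h, ?_, ?_, ?_⟩
    · intro i
      refine Fin.cases ?_ (fun i => ?_) i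
      · simpa using ⟨hg, hf 0⟩
      · simpa using hh0 i
    · intro i
      refine Fin.cases ?_ (fun i => ?_) i
      · simp
      · simpa using hhf i
    · rw [Fin.sum_univ_succ]
      simp [hs]

theorem aux_ref {L : Type*} [AddCommGroup L] [Lattice L] [IsOrderedAddMonoid L] (n : ℕ) :
    ∀ (m : ℕ) (f : Fin n → L) (g : Fin m → L), (∀ i, 0 ≤ f i) → (∀ j, 0 ≤ g j) →
      ∑ i, f i = ∑ j, g j →
      ∃ h : Fin n → Fin m → L, (∀ i j, 0 ≤ h i j) ∧ (∀ i, ∑ j, h i j = f i) ∧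
        ∀ j, ∑ i, h i j = g j := by
  intro m
  induction m with
  | zero =>
    intro f g hf hg hfg
    simp only [Finset.univ_eq_empty, Finset.sum_empty] at hfg
    refine ⟨fun _ j => j.elim0, fun _ j => j.elim0, fun i => ?_, fun j => j.elim0⟩
    have := (Finset.sum_eq_zero_iff_of_nonneg (fun i _ => hf i)).1 hfg i (Finset.mem_univ i)
    simp [this]
  | succ m ih =>
    intro f g hf hg hfg
    rw [Fin.sum_univ_succ] at hfg
    obtain ⟨k, hk0, hkf, hks⟩ := aux_dec n f (g 0) hf (hg 0)
      (by rw [hfg]; exact le_add_of_nonneg_right (Finset.sum_nonneg fun i _ => hg _))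
    obtain ⟨h, h0, h1, h2⟩ := ih (fun i => f i - k i) (fun j => g j.succ)
      (fun i => sub_nonneg.2 (hkf i)) (fun j => hg _)
      (by rw [Finset.sum_sub_distrib, hks, hfg]; simp)
    refine ⟨fun i => Fin.cons (k i) (h i), ?_, ?_, ?_⟩
    · intro i j
      refine Fin.cases ?_ (fun j => ?_) j
      · simpa using hk0 i
      · simpa using h0 i j
    · intro i
      rw [Fin.sum_univ_succ]
      simp [h1]
    · intro j
      refine Fin.cases ?_ (fun j => ?_) j
      · simpa using hks
      · simpa using h2 j

theorem aux_abs {L ι : Type*} [AddCommGroup L] [Lattice L] [IsOrderedAddMonoid L]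
    (s : Finset ι) (f : ι → L) : |∑ i ∈ s, f i| ≤ ∑ i ∈ s, |f i| :=
  Finset.le_sum_of_subadditive (fun a : L => |a|) (by simp) (fun a b => abs_add_le a b) s f

theorem aux_norm_add {X : Type*} [MeasurableSpace X] {μ : Measure X} (a b : Lp ℝ 1 μ)
    (ha : 0 ≤ a) (hb : 0 ≤ b) : ‖a + b‖ = ‖a‖ + ‖b‖ := by
  rw [L1.norm_eq_integral_norm, L1.norm_eq_integral_norm, L1.norm_eq_integral_norm,
    ← integral_add (L1.integrable_coeFn a).norm (L1.integrable_coeFn b).norm]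
  refine integral_congr_ae ?_
  filter_upwards [Lp.coeFn_add a b, (Lp.coeFn_nonneg a).2 ha, (Lp.coeFn_nonneg b).2 hb]
    with t h1 h2 h3
  simp only [Pi.zero_apply] at h2 h3
  rw [h1, Pi.add_apply, Real.norm_of_nonneg h2, Real.norm_of_nonneg h3,
    Real.norm_of_nonneg (add_nonneg h2 h3)]

theorem aux_norm_sum {X : Type*} [MeasurableSpace X] {μ : Measure X} {ι : Type*}
    (s : Finset ι) (f : ι → Lp ℝ 1 μ) (hf : ∀ i, 0 ≤ f i) :
    ‖∑ i ∈ s, f i‖ = ∑ i ∈ s, ‖f i‖ := by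
  classical
  induction s using Finset.induction_on with
  | empty => simp
  | insert a s ha ih =>
    rw [Finset.sum_insert ha, Finset.sum_insert ha,
      aux_norm_add _ _ (hf a) (Finset.sum_nonneg fun i _ => hf i), ih]

theorem aux_bound {X : Type*} [MeasurableSpace X] {μ : Measure X}
    (T : Lp ℝ 1 μ →L[ℝ] Lp ℝ 1 μ) (x : Lp ℝ 1 μ) :
    ∀ y ∈ besbasSet T x, ‖y‖ ≤ ‖T‖ * ‖x‖ := by
  rintro y ⟨n, f, hf, hs, rfl⟩
  rw [aux_norm_sum _ _ (fun i => abs_nonneg _), ← hs, aux_norm_sum _ _ hf, Finset.mul_sum]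
  refine Finset.sum_le_sum fun i _ => ?_
  rw [norm_abs_eq_norm]
  exact T.le_opNorm _

theorem aux_dir {X : Type*} [MeasurableSpace X] {μ : Measure X}
    (T : Lp ℝ 1 μ →L[ℝ] Lp ℝ 1 μ) (x : Lp ℝ 1 μ) (a b : Lp ℝ 1 μ)
    (ha : a ∈ besbasSet T x) (hb : b ∈ besbasSet T x) :
    ∃ c ∈ besbasSet T x, a ≤ c ∧ b ≤ c := by
  obtain ⟨n, f, hf, hs, rfl⟩ := ha
  obtain ⟨m, g, hg, hs', rfl⟩ := hb
  obtain ⟨h, h0, h1, h2⟩ := aux_ref n m f g hf hg (hs.trans hs'.symm)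
  refine ⟨∑ i, ∑ j, |T (h i j)|, ⟨n * m, fun k => h (finProdFinEquiv.symm k).1
    (finProdFinEquiv.symm k).2, fun k => h0 _ _, ?_, ?_⟩, ?_, ?_⟩
  · rw [Equiv.sum_comp finProdFinEquiv.symm (fun p : Fin n × Fin m => h p.1 p.2),
      Fintype.sum_prod_type, ← hs]
    exact Finset.sum_congr rfl fun i _ => h1 i
  · rw [Equiv.sum_comp finProdFinEquiv.symm (fun p : Fin n × Fin m => |T (h p.1 p.2)|),
      Fintype.sum_prod_type]
  · refine Finset.sum_le_sum fun i _ => ?_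
    rw [← h1 i, map_sum]
    exact aux_abs _ _
  · rw [Finset.sum_comm]
    refine Finset.sum_le_sum fun j _ => ?_
    rw [← h2 j, map_sum]
    exact aux_abs _ _

theorem stmt_0 {X : Type*} [MeasurableSpace X] (μ : Measure X) [SigmaFinite μ]
    (T : Lp ℝ 1 μ →L[ℝ] Lp ℝ 1 μ) (x : Lp ℝ 1 μ) (hx : 0 ≤ x) :
    (∀ y ∈ besbasSet T x, ‖y‖ ≤ ‖T‖ * ‖x‖) ∧
    ∃ z : Lp ℝ 1 μ, ∀ y ∈ besbasSet T x, y ≤ z := by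
  refine ⟨aux_bound T x, ?_⟩
  have hne : Nonempty (besbasSet T x) :=
    ⟨⟨|T x|, 1, fun _ => x, fun _ => hx, by simp, by simp⟩⟩
  have hdir : IsDirectedOrder (besbasSet T x) := ⟨fun a b => by
    obtain ⟨c, hc, h1, h2⟩ := aux_dir T x a b a.2 b.2
    exact ⟨⟨c, hc⟩, h1, h2⟩⟩
  have hpos : ∀ y : besbasSet T x, (0 : Lp ℝ 1 μ) ≤ y := by
    rintro ⟨y, n, f, hf, hs, rfl⟩
    exact Finset.sum_nonneg (f := fun i => |T (f i)|) fun i _ => abs_nonneg (T (f i))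
  have hbdd : BddAbove (Set.range fun y : besbasSet T x => ‖(y : Lp ℝ 1 μ)‖) := by
    refine ⟨‖T‖ * ‖x‖, ?_⟩
    rintro _ ⟨y, rfl⟩
    exact aux_bound T x y y.2
  have hcau : Cauchy (map (fun y : besbasSet T x => (y : Lp ℝ 1 μ)) atTop) := by
    rw [Metric.cauchy_iff]
    refine ⟨inferInstance, fun ε hε => ?_⟩
    obtain ⟨y0, hy0⟩ := exists_lt_of_lt_ciSup
      (show (⨆ y : besbasSet T x, ‖(y : Lp ℝ 1 μ)‖) - ε / 2 < _ from sub_lt_self _ (half_pos hε))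
    have key : ∀ y : besbasSet T x, y0 ≤ y → dist (y : Lp ℝ 1 μ) y0 < ε / 2 := by
      intro y hy
      have h1 := aux_norm_add (y0 : Lp ℝ 1 μ) (y - y0) (hpos y0) (sub_nonneg.2 hy)
      rw [add_sub_cancel] at h1
      have h2 := le_ciSup hbdd y
      rw [dist_eq_norm]
      linarith
    refine ⟨_, image_mem_map (Ici_mem_atTop y0), ?_⟩
    rintro _ ⟨a, ha, rfl⟩ _ ⟨b, hb, rfl⟩
    have h1 := key a ha
    have h2 := key b hb
    have h3 := dist_triangle_right (a : Lp ℝ 1 μ) b y0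
    linarith
  obtain ⟨z, hz⟩ := CompleteSpace.complete hcau
  refine ⟨z, fun y hy => ?_⟩
  have hz' : Tendsto (fun y : besbasSet T x => (y : Lp ℝ 1 μ)) atTop (𝓝 z) := hz
  exact ge_of_tendsto hz' ((eventually_ge_atTop (⟨y, hy⟩ : besbasSet T x)).mono fun w hw => hw)
end

section
/- Let T : L¹(μ) → L¹(μ) be a bounded linear operator and let x ∈ L¹(μ) with x ≥ 0. Define E(x) = { |T x₁| + … + |T xₙ| : n ∈ ℕ, x₁, …, xₙ ∈ L¹(μ), xᵢ ≥ 0 for each i, and x₁ + … + xₙ = x }. Then E(x) is upward directed in the following strong sense: for any finitely many elements y₁, …, y_k ∈ E(x) there exists y ∈ E(x) with y₁ ∨ y₂ ∨ … ∨ y_k ≤ y. -/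
open MeasureTheory Filter Topology
open scoped ENNReal NNReal

lemma bb_split {G : Type*} [AddCommGroup G] [Lattice G] [IsOrderedAddMonoid G] (m : ℕ) :
    ∀ (b : Fin m → G) (a : G), (∀ j, 0 ≤ b j) → 0 ≤ a → a ≤ ∑ j, b j →
    ∃ c : Fin m → G, (∀ j, 0 ≤ c j) ∧ (∀ j, c j ≤ b j) ∧ ∑ j, c j = a := by
  induction m with
  | zero =>
    intro b a _ h0 h1
    refine ⟨fun _ => 0, fun j => le_rfl, fun j => j.elim0, ?_⟩
    simp at h1 ⊢
    exact le_antisymm h0 h1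
  | succ m ih =>
    intro b a hb h0 h1
    rw [Fin.sum_univ_succ] at h1
    obtain ⟨c, hc0, hcb, hcs⟩ := ih (fun j => b j.succ) (a - a ⊓ b 0) (fun j => hb _)
      (sub_nonneg.2 inf_le_left) (by
        rw [sub_le_iff_le_add, add_inf]
        refine le_inf ?_ ?_
        · exact le_add_of_nonneg_left (Finset.sum_nonneg fun j _ => hb _)
        · rwa [add_comm])
    refine ⟨Fin.cons (a ⊓ b 0) c, ?_, ?_, ?_⟩
    · intro j
      refine Fin.cases ?_ (fun i => ?_) j
      · simpa using ⟨h0, hb 0⟩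
      · simpa using hc0 i
    · intro j
      refine Fin.cases ?_ (fun i => ?_) j
      · simp
      · simpa using hcb i
    · rw [Fin.sum_univ_succ]
      simp [hcs]

lemma bb_refine {G : Type*} [AddCommGroup G] [Lattice G] [IsOrderedAddMonoid G] (n m : ℕ) :
    ∀ (a : Fin n → G) (b : Fin m → G), (∀ i, 0 ≤ a i) → (∀ j, 0 ≤ b j) →
    ∑ i, a i = ∑ j, b j →
    ∃ c : Fin n → Fin m → G, (∀ i j, 0 ≤ c i j) ∧ (∀ i, ∑ j, c i j = a i) ∧
      (∀ j, ∑ i, c i j = b j) := by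
  induction n with
  | zero =>
    intro a b _ hb h
    refine ⟨fun i => i.elim0, fun i => i.elim0, fun i => i.elim0, fun j => ?_⟩
    simp only [Finset.univ_eq_empty, Finset.sum_empty] at h ⊢
    exact ((Finset.sum_eq_zero_iff_of_nonneg fun j _ => hb j).1 h.symm j (Finset.mem_univ _)).symm
  | succ n ih =>
    intro a b ha hb h
    rw [Fin.sum_univ_succ] at h
    obtain ⟨d, hd0, hdb, hds⟩ := bb_split m b (a 0) hb (ha 0) (by
      rw [← h]; exact le_add_of_nonneg_right (Finset.sum_nonneg fun j _ => ha _))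
    obtain ⟨c, hc0, hca, hcb⟩ := ih (fun i => a i.succ) (fun j => b j - d j) (fun i => ha _)
      (fun j => sub_nonneg.2 (hdb j)) (by
        rw [Finset.sum_sub_distrib, hds, ← h]; abel)
    refine ⟨Fin.cons d c, ?_, ?_, ?_⟩
    · intro i
      refine Fin.cases ?_ (fun i => ?_) i
      · simpa using hd0
      · simpa using hc0 i
    · intro i
      refine Fin.cases ?_ (fun i => ?_) i
      · simpa using hds
      · simpa using hca i
    · intro j
      rw [Fin.sum_univ_succ]
      simp [hcb]

lemma bb_abs_sum {G ι : Type*} [AddCommGroup G] [Lattice G] [IsOrderedAddMonoid G]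
    (s : Finset ι) (f : ι → G) : |∑ i ∈ s, f i| ≤ ∑ i ∈ s, |f i| :=
  Finset.le_sum_of_subadditive (fun x : G => |x|) abs_zero.le abs_add_le s f

lemma bb_two {X : Type*} [MeasurableSpace X] {μ : Measure X}
    (T : Lp ℝ 1 μ →L[ℝ] Lp ℝ 1 μ) (x u v : Lp ℝ 1 μ)
    (hu : u ∈ besbasSet T x) (hv : v ∈ besbasSet T x) :
    ∃ z ∈ besbasSet T x, u ≤ z ∧ v ≤ z := by
  obtain ⟨n, a, ha, has, rfl⟩ := hu
  obtain ⟨m, b, hb, hbs, rfl⟩ := hv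
  obtain ⟨c, hc, hca, hcb⟩ := bb_refine n m a b ha hb (has.trans hbs.symm)
  refine ⟨∑ i, ∑ j, |T (c i j)|, ⟨n * m, fun p => c (finProdFinEquiv.symm p).1
    (finProdFinEquiv.symm p).2, fun p => hc _ _, ?_, ?_⟩, ?_, ?_⟩
  · rw [Equiv.sum_comp finProdFinEquiv.symm (fun p => c p.1 p.2), Fintype.sum_prod_type]
    simp only [hca, has]
  · rw [Equiv.sum_comp finProdFinEquiv.symm (fun p => |T (c p.1 p.2)|), Fintype.sum_prod_type]
  · refine Finset.sum_le_sum fun i _ => ?_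
    rw [← hca i, map_sum]
    exact bb_abs_sum _ _
  · rw [Finset.sum_comm]
    refine Finset.sum_le_sum fun j _ => ?_
    rw [← hcb j, map_sum]
    exact bb_abs_sum _ _

theorem stmt_1 {X : Type*} [MeasurableSpace X] (μ : Measure X) [SigmaFinite μ]
    (T : Lp ℝ 1 μ →L[ℝ] Lp ℝ 1 μ) (x : Lp ℝ 1 μ) (hx : 0 ≤ x)
    (k : ℕ) (y : Fin k → Lp ℝ 1 μ) (hy : ∀ i, y i ∈ besbasSet T x) :
    ∃ z ∈ besbasSet T x, ∀ i, y i ≤ z := by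
  induction k with
  | zero => exact ⟨|T x|, ⟨1, fun _ => x, fun _ => hx, by simp, by simp⟩, fun i => i.elim0⟩
  | succ k ih =>
    obtain ⟨z, hz, hyz⟩ := ih (fun i => y i.succ) (fun i => hy _)
    obtain ⟨w, hw, h1, h2⟩ := bb_two T x (y 0) z (hy 0) hz
    exact ⟨w, hw, fun i => Fin.cases h1 (fun i => (hyz i).trans h2) i⟩
end

section
/- Let T : L¹(μ) → L¹(μ) be a bounded linear operator. Then T maps order-bounded sets to order-bounded sets: for every F ⊆ L¹(μ) for which there exists g ∈ L¹(μ) with |f| ≤ g for all f ∈ F, there exists h ∈ L¹(μ) with |T f| ≤ h for all f ∈ F. -/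
open MeasureTheory Filter Topology
open scoped ENNReal NNReal

section aux
variable {E : Type*} [NormedAddCommGroup E] [Lattice E] [IsOrderedAddMonoid E] [HasSolidNorm E]
  [NormedSpace ℝ E]

/-- `PartVal T g a`: there is a finite decomposition of `g` into positive parts `x` with
`a` the sum of the `|T x|`. -/
inductive PartVal (T : E →L[ℝ] E) : E → E → Prop
  | nil : PartVal T 0 0
  | cons (x y a : E) : 0 ≤ x → PartVal T y a → PartVal T (x + y) (|T x| + a)

variable {T : E →L[ℝ] E}

theorem PartVal.nonneg {g a : E} (h : PartVal T g a) : 0 ≤ g ∧ 0 ≤ a := by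
  induction h with
  | nil => simp
  | cons x y a hx h ih => exact ⟨add_nonneg hx ih.1, add_nonneg (abs_nonneg _) ih.2⟩

theorem PartVal.norm_le (hadd : ∀ a b : E, 0 ≤ a → 0 ≤ b → ‖a + b‖ = ‖a‖ + ‖b‖)
    {g a : E} (h : PartVal T g a) : ‖a‖ ≤ ‖T‖ * ‖g‖ := by
  induction h with
  | nil => simp
  | cons x y a hx h ih =>
    rw [hadd x y hx h.nonneg.1, hadd _ a (abs_nonneg _) h.nonneg.2, norm_abs_eq_norm]
    have := T.le_opNorm x
    linarith

theorem PartVal.add {g a g' a' : E} (h : PartVal T g a) (h' : PartVal T g' a') :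
    PartVal T (g + g') (a + a') := by
  induction h with
  | nil => simpa using h'
  | cons x y a hx h ih => rw [add_assoc, add_assoc]; exact .cons _ _ _ hx ih

theorem PartVal.split {g a : E} (h : PartVal T g a) : ∀ x y : E, 0 ≤ x → 0 ≤ y → g = x + y →
    ∃ b c, PartVal T x b ∧ PartVal T y c ∧ a ≤ b + c := by
  induction h with
  | nil =>
    intro x y hx hy h
    obtain ⟨rfl, rfl⟩ := (add_eq_zero_iff_of_nonneg hx hy).1 h.symm
    exact ⟨0, 0, .nil, .nil, by simp⟩
  | cons z t a hz h ih =>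
    intro x y hx hy e
    have ht := h.nonneg.1
    have h1 : 0 ≤ z ⊓ x := le_inf hz hx
    have h2 : 0 ≤ z - z ⊓ x := sub_nonneg.2 inf_le_left
    have h3 : z - z ⊓ x ≤ y := by
      rw [sub_le_iff_le_add, ← sub_le_iff_le_add']
      refine le_inf (sub_le_self _ hy) ?_
      rw [sub_le_iff_le_add, ← e]
      exact le_add_of_nonneg_right ht
    obtain ⟨b, c, hb, hc, hle⟩ := ih (x - z ⊓ x) (y - (z - z ⊓ x)) (sub_nonneg.2 inf_le_right)
      (sub_nonneg.2 h3) (by rw [eq_sub_of_add_eq' e]; abel)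
    refine ⟨|T (z ⊓ x)| + b, |T (z - z ⊓ x)| + c, ?_, ?_, ?_⟩
    · have := PartVal.cons _ _ _ h1 hb
      rwa [add_sub_cancel] at this
    · have := PartVal.cons _ _ _ h2 hc
      rwa [add_sub_cancel] at this
    · have h5 : |T z| ≤ |T (z ⊓ x)| + |T (z - z ⊓ x)| := by
        have := abs_add_le (T (z ⊓ x)) (T (z - z ⊓ x))
        rwa [← map_add, add_sub_cancel] at this
      calc |T z| + a ≤ (|T (z ⊓ x)| + |T (z - z ⊓ x)|) + (b + c) := add_le_add h5 hle
        _ = _ := by abel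

theorem PartVal.directed {g a : E} (h : PartVal T g a) : ∀ b, PartVal T g b →
    ∃ c, PartVal T g c ∧ a ≤ c ∧ b ≤ c := by
  induction h with
  | nil => intro b hb; exact ⟨b, hb, hb.nonneg.2, le_rfl⟩
  | cons x y a hx h ih =>
    intro b hb
    obtain ⟨b1, b2, h1, h2, hle⟩ := hb.split x y hx h.nonneg.1 rfl
    obtain ⟨c, hc, hac, hbc⟩ := ih b2 h2
    refine ⟨b1 + c, h1.add hc, add_le_add ?_ hac, hle.trans (by gcongr)⟩
    clear hle hb
    induction h1 with
    | nil => simp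
    | cons x y a hx h ih =>
      rw [map_add]
      exact (abs_add_le _ _).trans (by gcongr; exact ih h.nonneg.1)

theorem exists_upper [CompleteSpace E]
    (hadd : ∀ a b : E, 0 ≤ a → 0 ≤ b → ‖a + b‖ = ‖a‖ + ‖b‖) (T : E →L[ℝ] E)
    {g : E} (hg : 0 ≤ g) : ∃ h, ∀ a, PartVal T g a → a ≤ h := by
  let D := {a : E // PartVal T g a}
  have : Nonempty D := ⟨⟨|T g| + 0, by simpa only [add_zero] using PartVal.cons (T := T) g 0 0 hg .nil⟩⟩
  have : IsDirectedOrder D := ⟨fun a b => by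
    obtain ⟨c, hc, h1, h2⟩ := a.2.directed b.1 b.2
    exact ⟨⟨c, hc⟩, h1, h2⟩⟩
  have hsub : ∀ a b : D, a ≤ b → ‖b.1 - a.1‖ = ‖b.1‖ - ‖a.1‖ := fun a b hab => by
    have := hadd a.1 (b.1 - a.1) a.2.nonneg.2 (sub_nonneg.2 hab)
    rw [add_sub_cancel] at this
    linarith
  have hbdd : BddAbove (Set.range fun a : D => ‖a.1‖) :=
    ⟨‖T‖ * ‖g‖, by rintro _ ⟨a, rfl⟩; exact a.2.norm_le hadd⟩
  have hC : Cauchy (map (fun a : D => a.1) atTop) := by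
    rw [Metric.cauchy_iff]
    refine ⟨inferInstance, fun ε hε => ?_⟩
    obtain ⟨a0, h0⟩ := exists_lt_of_lt_ciSup
      (show (⨆ a : D, ‖a.1‖) - ε / 2 < ⨆ a : D, ‖a.1‖ by linarith)
    refine ⟨_, image_mem_map (Ici_mem_atTop a0), ?_⟩
    have key : ∀ a : D, a0 ≤ a → dist a.1 a0.1 < ε / 2 := fun a ha => by
      rw [dist_eq_norm, hsub _ _ ha]
      have := le_ciSup hbdd a
      linarith
    rintro _ ⟨a, ha, rfl⟩ _ ⟨b, hb, rfl⟩
    have := dist_triangle_right a.1 b.1 a0.1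
    linarith [key a ha, key b hb]
  obtain ⟨h, hh⟩ := CompleteSpace.complete hC
  refine ⟨h, fun a ha => ge_of_tendsto (f := fun a : D => a.1) hh ?_⟩
  filter_upwards [Ici_mem_atTop (⟨a, ha⟩ : D)] with b hb using hb

theorem exists_bound [CompleteSpace E]
    (hadd : ∀ a b : E, 0 ≤ a → 0 ≤ b → ‖a + b‖ = ‖a‖ + ‖b‖) (T : E →L[ℝ] E) (F : Set E)
    (hF : ∃ g : E, ∀ f ∈ F, |f| ≤ g) : ∃ h : E, ∀ f ∈ F, |T f| ≤ h := by
  obtain ⟨g, hg⟩ := hF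
  rcases F.eq_empty_or_nonempty with rfl | ⟨f0, hf0⟩
  · exact ⟨0, by simp⟩
  obtain ⟨h, hh⟩ := exists_upper hadd T ((abs_nonneg f0).trans (hg f0 hf0))
  refine ⟨h, fun f hf => ?_⟩
  have h1 := PartVal.cons (T := T) _ _ _ (posPart_nonneg f) (.cons _ _ _ (negPart_nonneg f)
    (.cons _ _ _ (sub_nonneg.2 (hg f hf)) .nil))
  have e : f⁺ + (f⁻ + (g - |f| + 0)) = g := by
    rw [← posPart_add_negPart f]; abel
  rw [e] at h1
  refine le_trans ?_ (hh _ h1)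
  calc |T f| = |T f⁺ + -T f⁻| := by rw [← sub_eq_add_neg, ← map_sub, posPart_sub_negPart]
    _ ≤ |T f⁺| + |T f⁻| := by simpa using abs_add_le (T f⁺) (-T f⁻)
    _ ≤ _ := by
      gcongr
      exact le_add_of_nonneg_right (by simp)

end aux

theorem stmt_2 {X : Type*} [MeasurableSpace X] (μ : Measure X) [SigmaFinite μ]
    (T : Lp ℝ 1 μ →L[ℝ] Lp ℝ 1 μ) (F : Set (Lp ℝ 1 μ))
    (hF : ∃ g : Lp ℝ 1 μ, ∀ f ∈ F, |f| ≤ g) :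
    ∃ h : Lp ℝ 1 μ, ∀ f ∈ F, |T f| ≤ h := by
  refine exists_bound (fun a b ha hb => ?_) T F hF
  rw [L1.norm_eq_integral_norm, L1.norm_eq_integral_norm, L1.norm_eq_integral_norm,
    ← integral_add (L1.integrable_coeFn a).norm (L1.integrable_coeFn b).norm]
  refine integral_congr_ae ?_
  filter_upwards [Lp.coeFn_add a b, (Lp.coeFn_nonneg a).2 ha, (Lp.coeFn_nonneg b).2 hb]
    with x h1 h2 h3
  simp only [Pi.zero_apply] at h2 h3
  rw [h1, Pi.add_apply, Real.norm_of_nonneg h2, Real.norm_of_nonneg h3,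
    Real.norm_of_nonneg (add_nonneg h2 h3)]
end

section
/- Let T : L¹(μ) → L¹(μ) be a bounded linear operator. Then there exists a unique bounded positive linear operator |T| : L¹(μ) → L¹(μ) such that, for every x ∈ L¹(μ) with x ≥ 0, |T| x is the least upper bound in L¹(μ) of the set { |T y| : y ∈ L¹(μ), |y| ≤ x }. Moreover |T| satisfies: (i) the operator norms of T and |T| coincide; (ii) |T x| ≤ |T| |x| for every x ∈ L¹(μ). -/
open MeasureTheory Filter Topology
open scoped ENNReal NNReal

namespace AbsOp

variable {X : Type*} [MeasurableSpace X] {μ : Measure X}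

theorem norm_add_nn (f g : Lp ℝ 1 μ) (hf : 0 ≤ f) (hg : 0 ≤ g) : ‖f + g‖ = ‖f‖ + ‖g‖ := by
  rw [L1.norm_eq_integral_norm, L1.norm_eq_integral_norm, L1.norm_eq_integral_norm,
    ← integral_add (L1.integrable_coeFn f).norm (L1.integrable_coeFn g).norm]
  apply integral_congr_ae
  filter_upwards [Lp.coeFn_add f g, (Lp.coeFn_nonneg f).2 hf, (Lp.coeFn_nonneg g).2 hg]
    with x h1 h2 h3
  simp only [Pi.zero_apply] at h2 h3
  rw [h1, Pi.add_apply, Real.norm_of_nonneg h2, Real.norm_of_nonneg h3,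
    Real.norm_of_nonneg (add_nonneg h2 h3)]

theorem exists_lub (D : Set (Lp ℝ 1 μ)) (hne : D.Nonempty) (h0 : ∀ w ∈ D, 0 ≤ w)
    (hdir : ∀ u ∈ D, ∀ v ∈ D, ∃ w ∈ D, u ≤ w ∧ v ≤ w) (C : ℝ) (hC : ∀ w ∈ D, ‖w‖ ≤ C) :
    ∃ s, IsLUB D s ∧ ‖s‖ ≤ C := by
  haveI : Nonempty D := hne.to_subtype
  haveI : IsDirectedOrder D := ⟨fun u v => by
    obtain ⟨w, hw, h1, h2⟩ := hdir u u.2 v v.2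
    exact ⟨⟨w, hw⟩, h1, h2⟩⟩
  have hsub : ∀ u v : D, u ≤ v → ‖(v : Lp ℝ 1 μ) - u‖ = ‖(v : Lp ℝ 1 μ)‖ - ‖(u : Lp ℝ 1 μ)‖ := by
    intro u v huv
    have := norm_add_nn (v - u : Lp ℝ 1 μ) u (sub_nonneg.2 huv) (h0 u u.2)
    rw [sub_add_cancel] at this
    linarith
  have hbdd : BddAbove (Set.range fun u : D => ‖(u : Lp ℝ 1 μ)‖) := ⟨C, by
    rintro _ ⟨u, rfl⟩; exact hC u u.2⟩
  have hcau : Cauchy (map (fun u : D => (u : Lp ℝ 1 μ)) atTop) := by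
    rw [Metric.cauchy_iff]
    refine ⟨inferInstance, fun ε hε => ?_⟩
    obtain ⟨d, hd⟩ := exists_lt_of_lt_ciSup
      (show (⨆ u : D, ‖(u : Lp ℝ 1 μ)‖) - ε / 2 < ⨆ u : D, ‖(u : Lp ℝ 1 μ)‖ by linarith)
    refine ⟨_, image_mem_map (mem_atTop d), ?_⟩
    rintro _ ⟨u, hu, rfl⟩ _ ⟨v, hv, rfl⟩
    have e1 := hsub d u hu
    have e2 := hsub d v hv
    have b1 := le_ciSup hbdd u
    have b2 := le_ciSup hbdd v
    have := dist_triangle_right (u : Lp ℝ 1 μ) v d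
    rw [dist_eq_norm (u : Lp ℝ 1 μ) d, dist_eq_norm (v : Lp ℝ 1 μ) d] at this
    linarith
  obtain ⟨s, hs⟩ := CompleteSpace.complete hcau
  have hs' : Tendsto (fun u : D => (u : Lp ℝ 1 μ)) atTop (𝓝 s) := hs
  refine ⟨s, ?_, le_of_tendsto' hs'.norm fun u => hC u u.2⟩
  have := isLUB_of_tendsto_atTop (f := fun u : D => (u : Lp ℝ 1 μ)) (fun u v huv => huv) hs'
  rwa [Subtype.range_coe] at this

/-- Values of the sums of `|T x_i|` over finite nonnegative decompositions of `x`. -/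
inductive DD (T : Lp ℝ 1 μ →L[ℝ] Lp ℝ 1 μ) : Lp ℝ 1 μ → Lp ℝ 1 μ → Prop
  | single (x : Lp ℝ 1 μ) (hx : 0 ≤ x) : DD T x |T x|
  | add (x y v w : Lp ℝ 1 μ) (h1 : DD T x v) (h2 : DD T y w) : DD T (x + y) (v + w)

variable {T : Lp ℝ 1 μ →L[ℝ] Lp ℝ 1 μ}

theorem DD.nn {x w : Lp ℝ 1 μ} (h : DD T x w) : 0 ≤ x ∧ 0 ≤ w := by
  induction h with
  | single x hx => exact ⟨hx, abs_nonneg _⟩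
  | add x y v w h1 h2 i1 i2 => exact ⟨add_nonneg i1.1 i2.1, add_nonneg i1.2 i2.2⟩

theorem DD.norm {x w : Lp ℝ 1 μ} (h : DD T x w) : ‖w‖ ≤ ‖T‖ * ‖x‖ := by
  induction h with
  | single x hx => rw [norm_abs_eq_norm]; exact T.le_opNorm x
  | add x y v w h1 h2 i1 i2 =>
    rw [norm_add_nn _ _ h1.nn.1 h2.nn.1, norm_add_nn _ _ h1.nn.2 h2.nn.2]
    linarith

theorem DD.ge {x w : Lp ℝ 1 μ} (h : DD T x w) : |T x| ≤ w := by
  induction h with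
  | single x hx => exact le_rfl
  | add x y v w h1 h2 i1 i2 =>
    rw [map_add]
    exact (abs_add_le _ _).trans (add_le_add i1 i2)

theorem DD.split {z w : Lp ℝ 1 μ} (h : DD T z w) : ∀ x y : Lp ℝ 1 μ, 0 ≤ x → 0 ≤ y → z = x + y →
    ∃ u v, DD T x u ∧ DD T y v ∧ w ≤ u + v := by
  induction h with
  | single z hz =>
    rintro x y hx hy rfl
    refine ⟨_, _, .single x hx, .single y hy, ?_⟩
    rw [map_add]
    exact abs_add_le _ _
  | add a b v w h1 h2 i1 i2 =>
    intro x y hx hy hxy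
    have ha := h1.nn.1
    have hb := h2.nn.1
    have hab : x ≤ a + b := by rw [hxy]; exact le_add_of_nonneg_right hy
    obtain ⟨u1, v1, p1, q1, r1⟩ := i1 (a ⊓ x) (a - a ⊓ x) (le_inf ha hx)
      (sub_nonneg.2 inf_le_left) (by abel)
    obtain ⟨u2, v2, p2, q2, r2⟩ := i2 (x - a ⊓ x) (b - (x - a ⊓ x))
      (sub_nonneg.2 inf_le_right) (by
        have : x - b ≤ a ⊓ x := le_inf (sub_le_iff_le_add.2 hab) (sub_le_self _ hb)
        have h := sub_nonneg.2 this
        have e : b - (x - a ⊓ x) = a ⊓ x - (x - b) := by abel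
        rwa [e]) (by abel)
    refine ⟨u1 + u2, v1 + v2, ?_, ?_, ?_⟩
    · have := DD.add _ _ _ _ p1 p2
      rwa [add_sub_cancel] at this
    · have := DD.add _ _ _ _ q1 q2
      have e : a - a ⊓ x + (b - (x - a ⊓ x)) = y := by
        have : y = a + b - x := by rw [hxy]; abel
        rw [this]; abel
      rwa [e] at this
    · calc v + w ≤ (u1 + v1) + (u2 + v2) := add_le_add r1 r2
        _ = _ := by abel

theorem DD.dir {x u : Lp ℝ 1 μ} (h : DD T x u) : ∀ v, DD T x v →
    ∃ w, DD T x w ∧ u ≤ w ∧ v ≤ w := by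
  induction h with
  | single x hx => exact fun v hv => ⟨v, hv, hv.ge, le_rfl⟩
  | add a b s t h1 h2 i1 i2 =>
    intro v hv
    obtain ⟨v1, v2, p, q, r⟩ := hv.split a b h1.nn.1 h2.nn.1 rfl
    obtain ⟨w1, a1, b1, c1⟩ := i1 v1 p
    obtain ⟨w2, a2, b2, c2⟩ := i2 v2 q
    exact ⟨w1 + w2, .add _ _ _ _ a1 a2, add_le_add b1 b2, r.trans (add_le_add c1 c2)⟩

theorem DD.le_ub {x w : Lp ℝ 1 μ} (h : DD T x w) :
    ∀ b, (∀ y, |y| ≤ x → T y ≤ b) → w ≤ b := by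
  induction h with
  | single x hx =>
    intro b hb
    refine abs_le'.2 ⟨hb x (abs_of_nonneg hx).le, ?_⟩
    rw [← map_neg]
    exact hb (-x) (by rw [abs_neg, abs_of_nonneg hx])
  | add x x' v w h1 h2 i1 i2 =>
    intro b hb
    have : w ≤ b - v := i2 _ fun y' hy' => by
      have : v ≤ b - T y' := i1 _ fun y hy => by
        have := hb (y + y') ((abs_add_le _ _).trans (add_le_add hy hy'))
        rw [map_add] at this
        exact le_sub_iff_add_le.2 this
      exact le_sub_comm.1 this
    rw [add_comm]
    exact le_sub_iff_add_le.1 this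

theorem exists_s (T : Lp ℝ 1 μ →L[ℝ] Lp ℝ 1 μ) (x : Lp ℝ 1 μ) :
    ∃ s, 0 ≤ x → IsLUB {w | DD T x w} s ∧ ‖s‖ ≤ ‖T‖ * ‖x‖ := by
  by_cases hx : 0 ≤ x
  · obtain ⟨s, hs⟩ := exists_lub {w | DD T x w} ⟨_, .single x hx⟩ (fun w hw => hw.nn.2)
      (fun u hu v hv => hu.dir v hv) (‖T‖ * ‖x‖) (fun w hw => hw.norm)
    exact ⟨s, fun _ => hs⟩
  · exact ⟨0, fun h => absurd h hx⟩

theorem lub_iff {x s : Lp ℝ 1 μ} (hx : 0 ≤ x) (hs : IsLUB {w | DD T x w} s) :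
    IsLUB {z : Lp ℝ 1 μ | ∃ y : Lp ℝ 1 μ, |y| ≤ x ∧ z = |T y|} s := by
  constructor
  · rintro _ ⟨y, hy, rfl⟩
    have h1 : DD T x (|T y⁺| + |T y⁻| + |T (x - |y|)|) := by
      have := DD.add _ _ _ _ (DD.add _ _ _ _ (DD.single (T := T) y⁺ (posPart_nonneg y))
        (.single y⁻ (negPart_nonneg y))) (.single (x - |y|) (sub_nonneg.2 hy))
      rwa [posPart_add_negPart, add_sub_cancel] at this
    refine le_trans ?_ (hs.1 h1)
    refine le_trans ?_ (le_add_of_nonneg_right (abs_nonneg _))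
    conv_lhs => rw [← posPart_sub_negPart y, map_sub, sub_eq_add_neg]
    refine (abs_add_le _ _).trans ?_
    rw [abs_neg]
  · intro b hb
    refine hs.2 fun w hw => hw.le_ub b fun y hy => (le_abs_self _).trans (hb ⟨y, hy, rfl⟩)

end AbsOp

open AbsOp
theorem stmt_4 {X : Type*} [MeasurableSpace X] (μ : Measure X) [SigmaFinite μ]
    (T : Lp ℝ 1 μ →L[ℝ] Lp ℝ 1 μ) :
    ∃ S : Lp ℝ 1 μ →L[ℝ] Lp ℝ 1 μ,
      ((∀ x : Lp ℝ 1 μ, 0 ≤ x → 0 ≤ S x) ∧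
        (∀ x : Lp ℝ 1 μ, 0 ≤ x →
          IsLUB {z : Lp ℝ 1 μ | ∃ y : Lp ℝ 1 μ, |y| ≤ x ∧ z = |T y|} (S x))) ∧
      (∀ S' : Lp ℝ 1 μ →L[ℝ] Lp ℝ 1 μ,
        ((∀ x : Lp ℝ 1 μ, 0 ≤ x → 0 ≤ S' x) ∧
          (∀ x : Lp ℝ 1 μ, 0 ≤ x →
            IsLUB {z : Lp ℝ 1 μ | ∃ y : Lp ℝ 1 μ, |y| ≤ x ∧ z = |T y|} (S' x))) →
        S' = S) ∧
      ‖S‖ = ‖T‖ ∧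
      (∀ x : Lp ℝ 1 μ, |T x| ≤ S |x|) := by
  classical
  choose s hs using exists_s T
  have hs0 : ∀ x, 0 ≤ x → 0 ≤ s x := fun x hx =>
    (abs_nonneg (T x)).trans ((hs x hx).1.1 (DD.single x hx))
  have hadd : ∀ x y, 0 ≤ x → 0 ≤ y → s (x + y) = s x + s y := by
    intro x y hx hy
    apply le_antisymm
    · refine (hs _ (add_nonneg hx hy)).1.2 fun w hw => ?_
      obtain ⟨u, v, p, q, r⟩ := DD.split hw x y hx hy rfl
      exact r.trans (add_le_add ((hs x hx).1.1 p) ((hs y hy).1.1 q))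
    · have h1 : ∀ v, DD T y v → s x ≤ s (x + y) - v := fun v hv =>
        (hs x hx).1.2 fun u hu => le_sub_iff_add_le.2
          ((hs _ (add_nonneg hx hy)).1.1 (DD.add _ _ _ _ hu hv))
      have h2 : s y ≤ s (x + y) - s x := (hs y hy).1.2 fun v hv => le_sub_comm.1 (h1 v hv)
      rw [add_comm]
      exact le_sub_iff_add_le.1 h2
  have hwd : ∀ a b c d : Lp ℝ 1 μ, 0 ≤ a → 0 ≤ b → 0 ≤ c → 0 ≤ d → a - b = c - d →
      s a - s b = s c - s d := by
    intro a b c d ha hb hc hd h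
    have h' : a + d = c + b := sub_eq_sub_iff_add_eq_add.1 h
    have := congrArg s h'
    rw [hadd _ _ ha hd, hadd _ _ hc hb] at this
    exact sub_eq_sub_iff_add_eq_add.2 this
  have hz : s 0 = 0 := by
    have := hadd 0 0 le_rfl le_rfl
    simpa using this
  let F : Lp ℝ 1 μ →+ Lp ℝ 1 μ := AddMonoidHom.mk' (fun x => s x⁺ - s x⁻) (by
    intro x y
    have := hwd (x + y)⁺ (x + y)⁻ (x⁺ + y⁺) (x⁻ + y⁻) (posPart_nonneg _) (negPart_nonneg _)
      (add_nonneg (posPart_nonneg _) (posPart_nonneg _))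
      (add_nonneg (negPart_nonneg _) (negPart_nonneg _)) (by
        rw [posPart_sub_negPart, add_sub_add_comm, posPart_sub_negPart, posPart_sub_negPart])
    rw [this, hadd _ _ (posPart_nonneg _) (posPart_nonneg _),
      hadd _ _ (negPart_nonneg _) (negPart_nonneg _)]
    abel)
  have hFb : ∀ x, ‖F x‖ ≤ ‖T‖ * ‖x‖ := by
    intro x
    have e : ‖x‖ = ‖x⁺‖ + ‖x⁻‖ := by
      rw [← norm_add_nn _ _ (posPart_nonneg x) (negPart_nonneg x), posPart_add_negPart,
        norm_abs_eq_norm]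
    calc ‖F x‖ = ‖s x⁺ - s x⁻‖ := rfl
      _ ≤ ‖s x⁺‖ + ‖s x⁻‖ := norm_sub_le _ _
      _ ≤ ‖T‖ * ‖x⁺‖ + ‖T‖ * ‖x⁻‖ :=
        add_le_add (hs _ (posPart_nonneg x)).2 (hs _ (negPart_nonneg x)).2
      _ = ‖T‖ * ‖x‖ := by rw [e]; ring
  have hFc : Continuous F := AddMonoidHomClass.continuous_of_bound F ‖T‖ hFb
  have hFs : ∀ x, 0 ≤ x → F x = s x := by
    intro x hx
    change s x⁺ - s x⁻ = s x
    rw [posPart_of_nonneg hx, negPart_of_nonneg hx, hz, sub_zero]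
  let S : Lp ℝ 1 μ →L[ℝ] Lp ℝ 1 μ := F.toRealLinearMap hFc
  have hSF : ∀ x, S x = F x := fun _ => rfl
  have hlub : ∀ x : Lp ℝ 1 μ, 0 ≤ x →
          IsLUB {z : Lp ℝ 1 μ | ∃ y : Lp ℝ 1 μ, |y| ≤ x ∧ z = |T y|} (S x) := by
    intro x hx
    rw [hSF, hFs x hx]
    exact lub_iff hx (hs x hx).1
  have habs : ∀ x : Lp ℝ 1 μ, |T x| ≤ S |x| := fun x =>
    (hlub |x| (abs_nonneg x)).1 ⟨x, le_rfl, rfl⟩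
  refine ⟨S, ⟨fun x hx => ?_, hlub⟩, ?_, ?_, habs⟩
  · rw [hSF, hFs x hx]; exact hs0 x hx
  · rintro S' ⟨-, h2⟩
    have hp : ∀ x, 0 ≤ x → S' x = S x := fun x hx => (h2 x hx).unique (hlub x hx)
    ext1 x
    rw [← posPart_sub_negPart x, map_sub, map_sub, hp _ (posPart_nonneg x),
      hp _ (negPart_nonneg x)]
  · apply le_antisymm
    · exact S.opNorm_le_bound (norm_nonneg _) hFb
    · refine T.opNorm_le_bound (norm_nonneg _) fun x => ?_
      have h1 : ‖T x‖ ≤ ‖S |x|‖ := norm_le_norm_of_abs_le_abs ((habs x).trans (le_abs_self _))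
      have h2 := S.le_opNorm |x|
      rw [norm_abs_eq_norm] at h2
      exact h1.trans h2
end
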